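/- arXiv:2511.11162 — 4 statements merged into one kernel-verified Lean document; each statement's English description precedes it below -/
import Mathlib

section
/- Let Ω ⊂ ℝⁿ be a nonempty bounded open convex set. There exists a constant K₁ > 0, depending only on Ω and n, such that for all convex functions u₁, u₂ : ℝⁿ → ℝ that are differentiable at every point of Ω with sup_{x∈Ω} ‖∇u₁(x)‖ < ∞ and sup_{x∈Ω} ‖∇u₂(x)‖ < ∞, one has (∫_Ω ‖∇u₁(x) − ∇u₂(x)‖² dx)^{1/2} ≤ 2·K₁ · (sup_{x∈Ω} |u₁(x) − u₂(x)|)^{1/2} · ((sup_{x∈Ω} ‖∇u₁(x)‖)^{1/2} + (sup_{x∈Ω} ‖∇u₂(x)‖)^{1/2}), where the integral is with respect to Lebesgue measure on Ω. -/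
open MeasureTheory
open Filter Topology

/-- A convex function lies above its tangent hyperplanes. -/
theorem ConvexOn.add_fderiv_le {E : Type*} [NormedAddCommGroup E] [NormedSpace ℝ E]
    {u : E → ℝ} (hu : ConvexOn ℝ Set.univ u) {x : E} (hx : DifferentiableAt ℝ u x) (z : E) :
    u x + fderiv ℝ u x z ≤ u (x + z) := by
  have hg : ConvexOn ℝ Set.univ (fun t : ℝ => u (x + t • z)) := by
    have h := hu.comp_affineMap (AffineMap.lineMap x (x + z) : ℝ →ᵃ[ℝ] E)
    have hfun : (u ∘ (AffineMap.lineMap x (x + z) : ℝ →ᵃ[ℝ] E)) = fun t : ℝ => u (x + t • z) := by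
      ext t
      simp [AffineMap.lineMap_apply, add_comm]
    rwa [hfun, Set.preimage_univ] at h
  have hd : HasDerivAt (fun t : ℝ => u (x + t • z)) (fderiv ℝ u x z) 0 :=
    hx.hasFDerivAt.hasLineDerivAt z
  have h := hg.le_slope_of_hasDerivAt (Set.mem_univ 0) (Set.mem_univ 1) one_pos hd
  simp only [slope_def_field, sub_zero, div_one, one_smul, zero_smul, add_zero] at h
  linarith

/-- If a convex open set contains a ball of radius `r`, then the part of it pushed outside by a
translation of length at most `t * r` has measure at most `finrank ℝ E * t` times that of the set. -/
theorem Convex.measureReal_diff_preimage_add_le {E : Type*} [NormedAddCommGroup E]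
    [NormedSpace ℝ E] [FiniteDimensional ℝ E] [MeasurableSpace E] [BorelSpace E]
    (μ : Measure E) [μ.IsAddHaarMeasure] {Ω : Set E} (hconv : Convex ℝ Ω) (hopen : IsOpen Ω)
    (hfin : μ Ω ≠ ⊤) {x₀ : E} {r : ℝ} (hball : Metric.closedBall x₀ r ⊆ Ω)
    {t : ℝ} (ht₀ : 0 < t) (ht₁ : t ≤ 1) {z : E} (hz : ‖z‖ ≤ t * r) :
    μ.real (Ω \ (Ω ∩ (fun x => x + z) ⁻¹' Ω)) ≤ Module.finrank ℝ E * t * μ.real Ω := by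
  have hr : 0 ≤ r := nonneg_of_mul_nonneg_right ((norm_nonneg z).trans hz) ht₀
  have hx₀ : x₀ ∈ Ω := hball (Metric.mem_closedBall_self hr)
  have hsub : AffineMap.homothety x₀ (1 - t) '' Ω ⊆ Ω ∩ (fun x => x + z) ⁻¹' Ω := by
    rintro _ ⟨y, hy, rfl⟩
    have hmem : x₀ + t⁻¹ • z ∈ Ω := hball <| by
      rw [mem_closedBall_iff_norm, add_sub_cancel_left, norm_smul, norm_inv, Real.norm_eq_abs,
        abs_of_pos ht₀, inv_mul_le_iff₀ ht₀]
      exact hz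
    constructor
    · convert hconv hy hx₀ (sub_nonneg.2 ht₁) ht₀.le (by ring) using 1
      simp only [AffineMap.homothety_apply, vsub_eq_sub, vadd_eq_add]
      module
    · have h := hconv hy hmem (sub_nonneg.2 ht₁) ht₀.le (by ring)
      rw [smul_add, smul_inv_smul₀ ht₀.ne'] at h
      rw [Set.mem_preimage]
      convert h using 1
      simp only [AffineMap.homothety_apply, vsub_eq_sub, vadd_eq_add]
      module
  have hmeas : MeasurableSet (Ω ∩ (fun x => x + z) ⁻¹' Ω) :=
    (hopen.inter (hopen.preimage (by fun_prop))).measurableSet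
  have hle : (1 - t) ^ Module.finrank ℝ E * μ.real Ω ≤
      μ.real (Ω ∩ (fun x => x + z) ⁻¹' Ω) := by
    refine le_trans (le_of_eq ?_)
      (measureReal_mono hsub (measure_ne_top_of_subset Set.inter_subset_left hfin))
    have hnn : 0 ≤ (1 - t) ^ Module.finrank ℝ E := pow_nonneg (sub_nonneg.2 ht₁) _
    rw [measureReal_def, measureReal_def, Measure.addHaar_image_homothety, ENNReal.toReal_mul,
      abs_of_nonneg hnn, ENNReal.toReal_ofReal hnn]
  have hbern := one_add_mul_le_pow (a := -t) (by linarith) (Module.finrank ℝ E)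
  rw [← sub_eq_add_neg 1 t] at hbern
  have hbern' := mul_le_mul_of_nonneg_right hbern (measureReal_nonneg (μ := μ) (s := Ω))
  rw [measureReal_sdiff Set.inter_subset_left hmeas hfin]
  linarith

/-- Integrals of a bounded function over two subsets of small co-measure are close. -/
theorem abs_setIntegral_sub_setIntegral_le {α : Type*} [MeasurableSpace α] {μ : Measure α}
    {Ω A B : Set α} (hfin : μ Ω ≠ ⊤) (hA : MeasurableSet A) (hB : MeasurableSet B)
    (hAΩ : A ⊆ Ω) (hBΩ : B ⊆ Ω) {f : α → ℝ} (hf : IntegrableOn f Ω μ) {C δ : ℝ} (hC : 0 ≤ C)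
    (hfC : ∀ x ∈ Ω, |f x| ≤ C) (hAδ : μ.real (Ω \ A) ≤ δ) (hBδ : μ.real (Ω \ B) ≤ δ) :
    |(∫ x in B, f x ∂μ) - ∫ x in A, f x ∂μ| ≤ 2 * δ * C := by
  have key : ∀ S : Set α, μ.real (Ω \ S) ≤ δ → |∫ x in Ω \ S, f x ∂μ| ≤ C * δ := fun S hS =>
    (norm_setIntegral_le_of_norm_le_const (f := f)
      (measure_ne_top_of_subset Set.sdiff_subset hfin).lt_top fun x hx => hfC x hx.1).trans
        (mul_le_mul_of_nonneg_left hS hC)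
  have h₁ := key A hAδ
  have h₂ := key B hBδ
  rw [setIntegral_sdiff hA hf hAΩ] at h₁
  rw [setIntegral_sdiff hB hf hBΩ] at h₂
  rw [abs_le] at *
  constructor <;> linarith

/-- A discrete integration by parts: if `a` is bounded and monotone under translation by `z`, then
the integral of `a` against the increments of `w` along `z` is controlled by the bound of `w` and the
measure lost under translation. -/
theorem abs_setIntegral_mul_shift_sub_le {G : Type*} [AddCommGroup G] [MeasurableSpace G]
    [MeasurableAdd₂ G] [MeasurableNeg G] (μ : Measure G) [μ.IsAddRightInvariant]
    {Ω : Set G} (hΩ : MeasurableSet Ω) (hfin : μ Ω ≠ ⊤) (z : G) {δ M D : ℝ}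
    (hδ₁ : μ.real (Ω \ (Ω ∩ (fun x => x + z) ⁻¹' Ω)) ≤ δ)
    (hδ₂ : μ.real (Ω \ (Ω ∩ (fun x => x + -z) ⁻¹' Ω)) ≤ δ)
    {a w : G → ℝ} (ha : Measurable a) (hw : Measurable w) (hM₀ : 0 ≤ M) (hD₀ : 0 ≤ D)
    (haM : ∀ x ∈ Ω, |a x| ≤ M) (hwD : ∀ x ∈ Ω, |w x| ≤ D)
    (hmono : ∀ x ∈ Ω, x + z ∈ Ω → a x ≤ a (x + z)) :
    |∫ x in Ω ∩ (fun x => x + z) ⁻¹' Ω, a x * (w (x + z) - w x) ∂μ| ≤ 4 * δ * D * M := by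
  set A := Ω ∩ (fun x => x + z) ⁻¹' Ω with hAdef
  set B := Ω ∩ (fun x => x + -z) ⁻¹' Ω with hBdef
  have hA : MeasurableSet A := hΩ.inter (measurable_add_const z hΩ)
  have hB : MeasurableSet B := hΩ.inter (measurable_add_const (-z) hΩ)
  have hAfin : μ A ≠ ⊤ := measure_ne_top_of_subset Set.inter_subset_left hfin
  have hshift : ∀ f : G → ℝ, ∫ x in A, f (x + z) ∂μ = ∫ x in B, f x ∂μ := fun f => by
    rw [← (measurePreserving_add_right μ z).setIntegral_preimage_emb
      (measurableEmbedding_addRight z) f B]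
    congr 2
    ext x
    simp [hAdef, hBdef, and_comm]
  have hint : ∀ {S : Set G} {f : G → ℝ} {C : ℝ}, μ S ≠ ⊤ → MeasurableSet S → Measurable f →
      (∀ x ∈ S, |f x| ≤ C) → IntegrableOn f S μ := fun hS hSm hf hC =>
    Measure.integrableOn_of_bounded hS hf.aestronglyMeasurable
      ((ae_restrict_iff' hSm).2 (Eventually.of_forall hC))
  have hwz : Measurable fun x => w (x + z) := hw.comp (measurable_add_const z)
  have haz : Measurable fun x => a (x + z) := ha.comp (measurable_add_const z)
  have hawM : ∀ x ∈ Ω, |a x * w x| ≤ M * D := fun x hx => by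
    rw [abs_mul]
    exact mul_le_mul (haM x hx) (hwD x hx) (abs_nonneg _) hM₀
  have hia : IntegrableOn a Ω μ := hint hfin hΩ ha haM
  have hiaw : IntegrableOn (fun x => a x * w x) Ω μ := hint hfin hΩ (ha.mul hw) hawM
  have hiaz : IntegrableOn (fun x => a (x + z)) A μ := hint hAfin hA haz fun x hx => haM _ hx.2
  have hiaA : IntegrableOn a A μ := hia.mono_set Set.inter_subset_left
  have hi₁ : IntegrableOn (fun x => a (x + z) * w (x + z)) A μ :=
    hint hAfin hA (haz.mul hwz) fun x hx => hawM _ hx.2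
  have hi₂ : IntegrableOn (fun x => a x * w x) A μ := hiaw.mono_set Set.inter_subset_left
  have hi₃ : IntegrableOn (fun x => (a (x + z) - a x) * w (x + z)) A μ :=
    hint (C := (M + M) * D) hAfin hA ((haz.sub ha).mul hwz) fun x hx => by
      rw [abs_mul]
      exact mul_le_mul ((abs_sub _ _).trans (add_le_add (haM _ hx.2) (haM _ hx.1)))
        (hwD _ hx.2) (abs_nonneg _) (add_nonneg hM₀ hM₀)
  have hsplit : ∫ x in A, a x * (w (x + z) - w x) ∂μ =
      ((∫ x in B, a x * w x ∂μ) - ∫ x in A, a x * w x ∂μ) -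
        ∫ x in A, (a (x + z) - a x) * w (x + z) ∂μ := by
    rw [← hshift fun x => a x * w x, ← integral_sub hi₁ hi₂, ← integral_sub (Integrable.sub' hi₁ hi₂) hi₃]
    congr 1 with x
    ring
  have h₁ := abs_setIntegral_sub_setIntegral_le hfin hA hB Set.inter_subset_left
    Set.inter_subset_left hiaw (mul_nonneg hM₀ hD₀) hawM hδ₁ hδ₂
  have h₂ : |∫ x in A, (a (x + z) - a x) * w (x + z) ∂μ| ≤ D * (2 * δ * M) := by
    calc |∫ x in A, (a (x + z) - a x) * w (x + z) ∂μ|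
        ≤ ∫ x in A, |(a (x + z) - a x) * w (x + z)| ∂μ := abs_integral_le_integral_abs
      _ ≤ ∫ x in A, D * (a (x + z) - a x) ∂μ := by
        refine setIntegral_mono_on hi₃.abs ((hiaz.sub hiaA).const_mul D) hA fun x hx => ?_
        have hnn := sub_nonneg.2 (hmono x hx.1 hx.2)
        rw [abs_mul, abs_of_nonneg hnn, mul_comm D]
        exact mul_le_mul_of_nonneg_left (hwD _ hx.2) hnn
      _ = D * ((∫ x in B, a x ∂μ) - ∫ x in A, a x ∂μ) := by
        rw [integral_const_mul, integral_sub hiaz hiaA, hshift]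
      _ ≤ D * (2 * δ * M) := mul_le_mul_of_nonneg_left ((le_abs_self _).trans <|
        abs_setIntegral_sub_setIntegral_le hfin hA hB Set.inter_subset_left
          Set.inter_subset_left hia hM₀ haM hδ₁ hδ₂) hD₀
  rw [hsplit]
  rw [abs_le] at *
  constructor <;> linarith

/-- The `L²` distance between directional derivatives of two convex functions on a convex open set is
controlled by the sup-norm distance of the functions and the bounds of the derivatives. -/
theorem Convex.setIntegral_sq_fderiv_sub_le {E : Type*} [NormedAddCommGroup E]
    [NormedSpace ℝ E] [FiniteDimensional ℝ E] [MeasurableSpace E] [BorelSpace E]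
    (μ : Measure E) [μ.IsAddHaarMeasure] {Ω : Set E} (hconv : Convex ℝ Ω) (hopen : IsOpen Ω)
    (hfin : μ Ω ≠ ⊤) {x₀ : E} {r : ℝ} (hr : 0 < r) (hball : Metric.closedBall x₀ r ⊆ Ω)
    {e : E} (he : ‖e‖ ≤ 1) {u₁ u₂ : E → ℝ} (hu₁ : ConvexOn ℝ Set.univ u₁)
    (hu₂ : ConvexOn ℝ Set.univ u₂) (hd₁ : ∀ x ∈ Ω, DifferentiableAt ℝ u₁ x)
    (hd₂ : ∀ x ∈ Ω, DifferentiableAt ℝ u₂ x) {M₁ M₂ D : ℝ}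
    (hM₁ : ∀ x ∈ Ω, |fderiv ℝ u₁ x e| ≤ M₁) (hM₂ : ∀ x ∈ Ω, |fderiv ℝ u₂ x e| ≤ M₂)
    (hD : ∀ x ∈ Ω, |u₁ x - u₂ x| ≤ D) :
    ∫ x in Ω, (fderiv ℝ u₁ x e - fderiv ℝ u₂ x e) ^ 2 ∂μ ≤
      4 * Module.finrank ℝ E * μ.real Ω / r * D * (M₁ + M₂) := by
  have hx₀ : x₀ ∈ Ω := hball (Metric.mem_closedBall_self hr.le)
  have hM₁₀ : 0 ≤ M₁ := (abs_nonneg _).trans (hM₁ x₀ hx₀)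
  have hM₂₀ : 0 ≤ M₂ := (abs_nonneg _).trans (hM₂ x₀ hx₀)
  have hD₀ : 0 ≤ D := (abs_nonneg _).trans (hD x₀ hx₀)
  have hΩ := hopen.measurableSet
  set w : E → ℝ := fun x => u₁ x - u₂ x with hwdef
  have hw : Measurable w :=
    (hu₁.locallyLipschitz.continuous.sub hu₂.locallyLipschitz.continuous).measurable
  have hv₁ : Measurable fun x => fderiv ℝ u₁ x e := measurable_fderiv_apply_const ℝ u₁ e
  have hv₂ : Measurable fun x => fderiv ℝ u₂ x e := measurable_fderiv_apply_const ℝ u₂ e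
  have hv : ∀ x ∈ Ω, |fderiv ℝ u₁ x e - fderiv ℝ u₂ x e| ≤ M₁ + M₂ := fun x hx =>
    (abs_sub _ _).trans (add_le_add (hM₁ x hx) (hM₂ x hx))
  have hbd : ∀ {u : E → ℝ} {M : ℝ}, ConvexOn ℝ Set.univ u → (∀ x ∈ Ω, DifferentiableAt ℝ u x) →
      (∀ x ∈ Ω, |fderiv ℝ u x e| ≤ M) → ∀ h : ℝ, 0 < h → ∀ x ∈ Ω, x + h • e ∈ Ω →
      fderiv ℝ u x e ≤ fderiv ℝ u (x + h • e) e ∧ |u (x + h • e) - u x| ≤ h * M := by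
    intro u M hu hd hM h hh x hx hxh
    have h₁ := hu.add_fderiv_le (hd x hx) (h • e)
    have h₂ := hu.add_fderiv_le (hd _ hxh) (-(h • e))
    rw [map_neg, add_neg_cancel_right] at h₂
    simp only [map_smul, smul_eq_mul] at h₁ h₂
    have h₃ := abs_le.1 (hM x hx)
    have h₄ := abs_le.1 (hM _ hxh)
    refine ⟨le_of_mul_le_mul_left (by linarith) hh, abs_le.2 ⟨?_, ?_⟩⟩
    · nlinarith
    · nlinarith
  have hwbd : ∀ h : ℝ, 0 < h → ∀ x ∈ Ω, x + h • e ∈ Ω →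
      |h⁻¹ * (w (x + h • e) - w x)| ≤ M₁ + M₂ := by
    intro h hh x hx hxh
    have h₁ := (hbd hu₁ hd₁ hM₁ h hh x hx hxh).2
    have h₂ := (hbd hu₂ hd₂ hM₂ h hh x hx hxh).2
    rw [abs_mul, abs_of_pos (inv_pos.2 hh), inv_mul_le_iff₀ hh]
    have : w (x + h • e) - w x = (u₁ (x + h • e) - u₁ x) - (u₂ (x + h • e) - u₂ x) := by
      simp only [hwdef]; ring
    rw [this, mul_add]
    exact (abs_sub _ _).trans (add_le_add h₁ h₂)
  have hA : ∀ z : E, MeasurableSet (Ω ∩ (fun x => x + z) ⁻¹' Ω) := fun z =>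
    (hopen.inter (hopen.preimage (by fun_prop))).measurableSet
  let F : ℝ → E → ℝ := fun h => (Ω ∩ (fun x => x + h • e) ⁻¹' Ω).indicator fun x =>
    (fderiv ℝ u₁ x e - fderiv ℝ u₂ x e) * (h⁻¹ * (w (x + h • e) - w x))
  have hlim : Tendsto (fun h => ∫ x in Ω, F h x ∂μ) (𝓝[>] 0)
      (𝓝 (∫ x in Ω, (fderiv ℝ u₁ x e - fderiv ℝ u₂ x e) ^ 2 ∂μ)) := by
    refine tendsto_integral_filter_of_dominated_convergence
      (fun _ => (M₁ + M₂) * (M₁ + M₂)) ?_ ?_ ?_ ?_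
    · refine Eventually.of_forall fun h => (Measurable.indicator ?_ (hA _)).aestronglyMeasurable
      exact (hv₁.sub hv₂).mul
        (((hw.comp (measurable_add_const (h • e))).sub hw).const_mul _)
    · filter_upwards [self_mem_nhdsWithin] with h hh
      refine (ae_restrict_iff' hΩ).2 (Eventually.of_forall fun x hx => ?_)
      by_cases hxA : x ∈ Ω ∩ (fun x => x + h • e) ⁻¹' Ω
      · simp only [F, Set.indicator_of_mem hxA, Real.norm_eq_abs, abs_mul]
        rw [← abs_mul h⁻¹]
        exact mul_le_mul (hv x hx) (hwbd h hh x hx hxA.2) (abs_nonneg _) (by positivity)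
      · simp only [F, Set.indicator_of_notMem hxA, norm_zero]
        positivity
    · exact integrableOn_const hfin
    · refine (ae_restrict_iff' hΩ).2 (Eventually.of_forall fun x hx => ?_)
      have hder : HasLineDerivAt ℝ w (fderiv ℝ u₁ x e - fderiv ℝ u₂ x e) x e :=
        ((hd₁ x hx).hasFDerivAt.sub (hd₂ x hx).hasFDerivAt).hasLineDerivAt e
      have ht := (hder.tendsto_slope_zero_right).const_mul (fderiv ℝ u₁ x e - fderiv ℝ u₂ x e)
      rw [← sq] at ht
      refine ht.congr' ?_
      have hc : ContinuousAt (fun h : ℝ => x + h • e) 0 := by fun_prop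
      have hev : ∀ᶠ h : ℝ in 𝓝[>] 0, x + h • e ∈ Ω :=
        nhdsWithin_le_nhds (hc.eventually_mem (by simpa using hopen.mem_nhds hx))
      filter_upwards [hev] with h hh
      have hxA : x ∈ Ω ∩ (fun x => x + h • e) ⁻¹' Ω := ⟨hx, hh⟩
      simp only [F, Set.indicator_of_mem hxA, smul_eq_mul]
  refine le_of_tendsto hlim ?_
  filter_upwards [Ioo_mem_nhdsGT hr] with h ⟨hh, hhr⟩
  set δ : ℝ := Module.finrank ℝ E * (h / r) * μ.real Ω with hδ
  have hz : ‖h • e‖ ≤ h / r * r := by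
    rw [div_mul_cancel₀ _ hr.ne', norm_smul, Real.norm_eq_abs, abs_of_pos hh]
    exact mul_le_of_le_one_right hh.le he
  have hδ₁ := hconv.measureReal_diff_preimage_add_le μ hopen hfin hball (div_pos hh hr)
    ((div_le_one hr).2 hhr.le) hz
  have hδ₂ := hconv.measureReal_diff_preimage_add_le μ hopen hfin hball (div_pos hh hr)
    ((div_le_one hr).2 hhr.le) (z := -(h • e)) (by rwa [norm_neg])
  have hb₁ := abs_setIntegral_mul_shift_sub_le μ hΩ hfin (h • e) hδ₁ hδ₂ hv₁ hw hM₁₀ hD₀ hM₁ hD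
    fun x hx hxh => (hbd hu₁ hd₁ hM₁ h hh x hx hxh).1
  have hb₂ := abs_setIntegral_mul_shift_sub_le μ hΩ hfin (h • e) hδ₁ hδ₂ hv₂ hw hM₂₀ hD₀ hM₂ hD
    fun x hx hxh => (hbd hu₂ hd₂ hM₂ h hh x hx hxh).1
  set A := Ω ∩ (fun x => x + h • e) ⁻¹' Ω with hAdef
  have hint : ∀ {a : E → ℝ} {M : ℝ}, Measurable a → 0 ≤ M → (∀ x ∈ Ω, |a x| ≤ M) →
      IntegrableOn (fun x => a x * (w (x + h • e) - w x)) A μ := fun {a M} ha hM₀ hM =>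
    Measure.integrableOn_of_bounded (M := M * (D + D))
      (measure_ne_top_of_subset Set.inter_subset_left hfin)
      (ha.mul ((hw.comp (measurable_add_const _)).sub hw)).aestronglyMeasurable
      ((ae_restrict_iff' (hA _)).2 (Eventually.of_forall fun x hx => by
        rw [norm_mul]
        exact mul_le_mul (hM x hx.1) ((abs_sub _ _).trans (add_le_add (hD _ hx.2) (hD _ hx.1)))
          (norm_nonneg _) hM₀))
  have heq : ∫ x in Ω, F h x ∂μ = h⁻¹ *
      ((∫ x in A, fderiv ℝ u₁ x e * (w (x + h • e) - w x) ∂μ) -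
        ∫ x in A, fderiv ℝ u₂ x e * (w (x + h • e) - w x) ∂μ) := by
    rw [setIntegral_indicator (hA _), ← Set.inter_assoc, Set.inter_self,
      ← integral_sub (hint hv₁ hM₁₀ hM₁) (hint hv₂ hM₂₀ hM₂), ← integral_const_mul]
    congr 1 with x
    ring
  rw [heq, inv_mul_le_iff₀ hh]
  have hrhs : h * (4 * Module.finrank ℝ E * μ.real Ω / r * D * (M₁ + M₂)) =
      4 * δ * D * M₁ + 4 * δ * D * M₂ := by
    rw [hδ]; ring
  rw [hrhs]
  linarith [(abs_le.1 hb₁).2, (abs_le.1 hb₂).1]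

/-- Quantitative stability of gradients of convex functions: on a nonempty
bounded open convex set `Ω`, the `L²(Ω)` distance between the gradients of two
convex functions is controlled by the square root of the sup-norm distance of
the functions times the square roots of the sup-norms of the gradients. -/
theorem gradient_stability_convex {n : ℕ}
    (Ω : Set (EuclideanSpace ℝ (Fin n)))
    (hne : Ω.Nonempty) (hopen : IsOpen Ω) (hconv : Convex ℝ Ω)
    (hbdd : Bornology.IsBounded Ω) :
    ∃ K₁ > (0 : ℝ),
      ∀ u₁ u₂ : EuclideanSpace ℝ (Fin n) → ℝ,
        ConvexOn ℝ Set.univ u₁ → ConvexOn ℝ Set.univ u₂ →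
        (∀ x ∈ Ω, DifferentiableAt ℝ u₁ x) →
        (∀ x ∈ Ω, DifferentiableAt ℝ u₂ x) →
        BddAbove ((fun x => ‖gradient u₁ x‖) '' Ω) →
        BddAbove ((fun x => ‖gradient u₂ x‖) '' Ω) →
        Real.sqrt (∫ x in Ω, ‖gradient u₁ x - gradient u₂ x‖ ^ 2) ≤
          2 * K₁ * Real.sqrt (sSup ((fun x => |u₁ x - u₂ x|) '' Ω)) *
            (Real.sqrt (sSup ((fun x => ‖gradient u₁ x‖) '' Ω)) +
              Real.sqrt (sSup ((fun x => ‖gradient u₂ x‖) '' Ω))) := by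
  obtain ⟨x₀, hx₀⟩ := hne
  obtain ⟨r, hr, hball⟩ := Metric.nhds_basis_closedBall.mem_iff.1 (hopen.mem_nhds hx₀)
  have hfin : volume Ω ≠ ⊤ := hbdd.measure_lt_top.ne
  set C : ℝ := n * (4 * n * volume.real Ω / r) with hCdef
  have hC : 0 ≤ C := by positivity
  refine ⟨Real.sqrt C + 1, by positivity, fun u₁ u₂ hu₁ hu₂ hd₁ hd₂ hb₁ hb₂ => ?_⟩
  have hcont : Continuous fun x => |u₁ x - u₂ x| :=
    (hu₁.locallyLipschitz.continuous.sub hu₂.locallyLipschitz.continuous).abs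
  have hbD : BddAbove ((fun x => |u₁ x - u₂ x|) '' Ω) :=
    (hbdd.isCompact_closure.image hcont).bddAbove.mono (Set.image_mono subset_closure)
  have hle {f : EuclideanSpace ℝ (Fin n) → ℝ} (hf : BddAbove (f '' Ω)) :
      ∀ x ∈ Ω, f x ≤ sSup (f '' Ω) := fun x hx => le_csSup hf (Set.mem_image_of_mem f hx)
  have hD := hle hbD
  have hM₁ := hle hb₁
  have hM₂ := hle hb₂
  set D := sSup ((fun x => |u₁ x - u₂ x|) '' Ω)
  set M₁ := sSup ((fun x => ‖gradient u₁ x‖) '' Ω)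
  set M₂ := sSup ((fun x => ‖gradient u₂ x‖) '' Ω)
  have hD₀ : 0 ≤ D := (abs_nonneg _).trans (hD x₀ hx₀)
  have hM₁₀ : 0 ≤ M₁ := (norm_nonneg _).trans (hM₁ x₀ hx₀)
  have hM₂₀ : 0 ≤ M₂ := (norm_nonneg _).trans (hM₂ x₀ hx₀)
  let e : Fin n → EuclideanSpace ℝ (Fin n) := fun i => EuclideanSpace.single i 1
  have he : ∀ i, ‖e i‖ ≤ 1 := fun i => by simp [e]
  have hgrad : ∀ (u : EuclideanSpace ℝ (Fin n) → ℝ) x i, gradient u x i = fderiv ℝ u x (e i) :=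
    fun u x i => by
      rw [← toDual_gradient, InnerProductSpace.toDual_apply_apply,
        EuclideanSpace.inner_single_right, one_mul, conj_trivial]
  have hfd : ∀ {u : EuclideanSpace ℝ (Fin n) → ℝ} {M : ℝ}, (∀ x ∈ Ω, ‖gradient u x‖ ≤ M) →
      ∀ i, ∀ x ∈ Ω, |fderiv ℝ u x (e i)| ≤ M := fun {u M} hM i x hx => by
    rw [← hgrad]
    exact (PiLp.norm_apply_le (gradient u x) i).trans (hM x hx)
  have hsum : ∀ x, ‖gradient u₁ x - gradient u₂ x‖ ^ 2 =
      ∑ i, (fderiv ℝ u₁ x (e i) - fderiv ℝ u₂ x (e i)) ^ 2 := fun x => by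
    simp [EuclideanSpace.norm_sq_eq, hgrad]
  have hint : ∀ i, IntegrableOn
      (fun x => (fderiv ℝ u₁ x (e i) - fderiv ℝ u₂ x (e i)) ^ 2) Ω volume := fun i =>
    Measure.integrableOn_of_bounded (M := (M₁ + M₂) ^ 2) hfin
      (((measurable_fderiv_apply_const ℝ u₁ (e i)).sub
        (measurable_fderiv_apply_const ℝ u₂ (e i))).pow_const 2).aestronglyMeasurable
      ((ae_restrict_iff' hopen.measurableSet).2 (Eventually.of_forall fun x hx => by
        rw [norm_pow]
        exact pow_le_pow_left₀ (norm_nonneg _)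
          ((abs_sub _ _).trans (add_le_add (hfd hM₁ i x hx) (hfd hM₂ i x hx))) 2))
  have hmain : ∫ x in Ω, ‖gradient u₁ x - gradient u₂ x‖ ^ 2 ≤ C * D * (M₁ + M₂) := by
    simp_rw [hsum]
    rw [integral_finsetSum _ fun i _ => hint i]
    refine (Finset.sum_le_card_nsmul _ _ _ fun i _ =>
      hconv.setIntegral_sq_fderiv_sub_le volume hopen hfin hr hball (he i) hu₁ hu₂ hd₁ hd₂
        (hfd hM₁ i) (hfd hM₂ i) hD).trans_eq ?_
    rw [finrank_euclideanSpace_fin, Finset.card_univ, Fintype.card_fin, nsmul_eq_mul, hCdef]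
    ring
  have hsqrt : Real.sqrt (M₁ + M₂) ≤ Real.sqrt M₁ + Real.sqrt M₂ := by
    refine Real.sqrt_le_iff.2 ⟨by positivity, ?_⟩
    nlinarith [Real.sq_sqrt hM₁₀, Real.sq_sqrt hM₂₀,
      mul_nonneg (Real.sqrt_nonneg M₁) (Real.sqrt_nonneg M₂)]
  refine (Real.sqrt_le_sqrt hmain).trans ?_
  rw [Real.sqrt_mul (by positivity), Real.sqrt_mul hC]
  gcongr
  linarith [Real.sqrt_nonneg C]
end

section
/- Let μ be a probability measure on ℝⁿ and let u : ℝⁿ → ℝ be convex and differentiable at every point, with convex conjugate u*(y) = sup_{x∈ℝⁿ} (⟨x, y⟩ − u(x)). Assume x ↦ ‖x‖², x ↦ ‖∇u(x)‖², x ↦ u(x), and x ↦ u*(∇u(x)) are μ-integrable. Let T : ℝⁿ → ℝⁿ be Borel measurable with x ↦ ‖T(x)‖² and x ↦ u*(T(x)) μ-integrable, and suppose T#μ = (∇u)#μ. Then ∫ ‖x − ∇u(x)‖² dμ(x) ≤ ∫ ‖x − T(x)‖² dμ(x). -/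
open MeasureTheory
open scoped RealInnerProductSpace

/-- A convex function lies above its tangent hyperplanes. -/
lemma ConvexOn.add_inner_gradient_le {E : Type*} [NormedAddCommGroup E] [InnerProductSpace ℝ E]
    [CompleteSpace E] {u : E → ℝ} (hu : ConvexOn ℝ Set.univ u) {x : E}
    (hx : DifferentiableAt ℝ u x) (z : E) :
    u x + ⟪z - x, gradient u x⟫ ≤ u z := by
  have hline : ConvexOn ℝ Set.univ (u ∘ AffineMap.lineMap (k := ℝ) x z) := by
    simpa using hu.comp_affineMap (AffineMap.lineMap (k := ℝ) x z)
  have hderiv : HasDerivAt (u ∘ AffineMap.lineMap (k := ℝ) x z) (fderiv ℝ u x (z - x)) 0 := by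
    refine HasFDerivAt.comp_hasDerivAt (0 : ℝ) ?_ AffineMap.hasDerivAt_lineMap
    simpa using hx.hasFDerivAt
  have hslope := hline.le_slope_of_hasDerivAt (Set.mem_univ 0) (Set.mem_univ 1) one_pos hderiv
  have hinner : ⟪z - x, gradient u x⟫ = fderiv ℝ u x (z - x) := by
    rw [real_inner_comm, gradient, InnerProductSpace.toDual_symm_apply]
  simp only [slope_def_field, Function.comp_apply, AffineMap.lineMap_apply_one,
    AffineMap.lineMap_apply_zero, sub_zero, div_one] at hslope
  linarith

/-- Equality in the Fenchel–Young inequality at a gradient. -/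
lemma ConvexOn.inner_gradient_eq_add_conjugate {E : Type*} [NormedAddCommGroup E]
    [InnerProductSpace ℝ E] [CompleteSpace E] {u : E → ℝ} (hu : ConvexOn ℝ Set.univ u) {x : E}
    (hx : DifferentiableAt ℝ u x) {c : ℝ}
    (hc : IsLUB (Set.range fun z : E => ⟪z, gradient u x⟫ - u z) c) :
    ⟪x, gradient u x⟫ = u x + c := by
  have hle : ⟪x, gradient u x⟫ - u x ≤ c := hc.1 ⟨x, rfl⟩
  have hge : c ≤ ⟪x, gradient u x⟫ - u x := by
    refine hc.2 ?_
    rintro _ ⟨z, rfl⟩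
    have h := hu.add_inner_gradient_le hx z
    rw [inner_sub_left] at h
    show ⟪z, gradient u x⟫ - u z ≤ _
    linarith
  linarith

/-- A finite convex conjugate is Borel measurable, being a supremum of continuous functions. -/
lemma measurable_of_isLUB_inner_sub {E : Type*} [NormedAddCommGroup E] [InnerProductSpace ℝ E]
    [MeasurableSpace E] [BorelSpace E] {u ustar : E → ℝ}
    (h : ∀ y, IsLUB (Set.range fun x : E => ⟪x, y⟫ - u x) (ustar y)) : Measurable ustar := by
  have heq : ustar = fun y => ⨆ x : E, (⟪x, y⟫ - u x) :=
    funext fun y => ((h y).ciSup_eq).symm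
  rw [heq]
  refine (lowerSemicontinuous_ciSup (fun y => ⟨_, (h y).1⟩) fun x => ?_).measurable
  exact Continuous.lowerSemicontinuous (by fun_prop)

lemma measurable_gradient {E : Type*} [NormedAddCommGroup E] [InnerProductSpace ℝ E]
    [CompleteSpace E] [MeasurableSpace E] [BorelSpace E] (u : E → ℝ) :
    Measurable (gradient u) := by
  borelize (StrongDual ℝ E)
  exact (InnerProductSpace.toDual ℝ E).symm.continuous.measurable.comp (measurable_fderiv ℝ u)

lemma integrable_norm_sub_sq {α E : Type*} [MeasurableSpace α] [NormedAddCommGroup E]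
    {μ : Measure α} {f g : α → E} (hf : AEStronglyMeasurable f μ)
    (hg : AEStronglyMeasurable g μ) (hf2 : Integrable (fun x => ‖f x‖ ^ 2) μ)
    (hg2 : Integrable (fun x => ‖g x‖ ^ 2) μ) : Integrable (fun x => ‖f x - g x‖ ^ 2) μ :=
  (((memLp_two_iff_integrable_sq_norm hf).2 hf2).sub
    ((memLp_two_iff_integrable_sq_norm hg).2 hg2)).integrable_norm_pow two_ne_zero

/-- Brenier's optimality principle for the quadratic cost: the gradient of a
convex potential `u` minimizes the quadratic transport cost among all
measurable maps pushing `μ` to the same target measure. Here `ustar` is the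
convex conjugate `u*(y) = sup_x (⟨x, y⟩ − u(x))`. -/
theorem brenier_gradient_optimal {n : ℕ}
    (μ : Measure (EuclideanSpace ℝ (Fin n))) [IsProbabilityMeasure μ]
    (u : EuclideanSpace ℝ (Fin n) → ℝ)
    (hu : ConvexOn ℝ Set.univ u)
    (hdiff : ∀ x, DifferentiableAt ℝ u x)
    (ustar : EuclideanSpace ℝ (Fin n) → ℝ)
    (hustar : ∀ y, IsLUB (Set.range fun x : EuclideanSpace ℝ (Fin n) =>
      ⟪x, y⟫ - u x) (ustar y))
    (hmom : Integrable (fun x => ‖x‖ ^ 2) μ)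
    (hgrad2 : Integrable (fun x => ‖gradient u x‖ ^ 2) μ)
    (huint : Integrable u μ)
    (hconjgrad : Integrable (fun x => ustar (gradient u x)) μ)
    (T : EuclideanSpace ℝ (Fin n) → EuclideanSpace ℝ (Fin n))
    (hT : Measurable T)
    (hT2 : Integrable (fun x => ‖T x‖ ^ 2) μ)
    (hTconj : Integrable (fun x => ustar (T x)) μ)
    (hpush : μ.map T = μ.map (fun x => gradient u x)) :
    ∫ x, ‖x - gradient u x‖ ^ 2 ∂μ ≤ ∫ x, ‖x - T x‖ ^ 2 ∂μ := by
  have hG : Measurable (gradient u) := measurable_gradient u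
  have hnorm : ∫ x, ‖T x‖ ^ 2 ∂μ = ∫ x, ‖gradient u x‖ ^ 2 ∂μ := by
    have hm : Measurable fun y : EuclideanSpace ℝ (Fin n) => ‖y‖ ^ 2 := by fun_prop
    rw [← integral_map hT.aemeasurable hm.aestronglyMeasurable, hpush,
      integral_map hG.aemeasurable hm.aestronglyMeasurable]
  have hconj : ∫ x, ustar (T x) ∂μ = ∫ x, ustar (gradient u x) ∂μ := by
    have hm : Measurable ustar := measurable_of_isLUB_inner_sub hustar
    rw [← integral_map hT.aemeasurable hm.aestronglyMeasurable, hpush,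
      integral_map hG.aemeasurable hm.aestronglyMeasurable]
  have hsplit {S : EuclideanSpace ℝ (Fin n) → EuclideanSpace ℝ (Fin n)}
      (hS2 : Integrable (fun x => ‖S x‖ ^ 2) μ) (hSconj : Integrable (fun x => ustar (S x)) μ) :
      Integrable (fun x => ‖x‖ ^ 2 + ‖S x‖ ^ 2 - 2 * (u x + ustar (S x))) μ ∧
      ∫ x, (‖x‖ ^ 2 + ‖S x‖ ^ 2 - 2 * (u x + ustar (S x))) ∂μ =
        ∫ x, ‖x‖ ^ 2 ∂μ + ∫ x, ‖S x‖ ^ 2 ∂μ - 2 * (∫ x, u x ∂μ + ∫ x, ustar (S x) ∂μ) := by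
    have hcost : Integrable (fun x => ‖x‖ ^ 2 + ‖S x‖ ^ 2) μ := hmom.add hS2
    have hpot : Integrable (fun x => 2 * (u x + ustar (S x))) μ :=
      (huint.add hSconj).const_mul 2
    refine ⟨hcost.sub hpot, ?_⟩
    rw [integral_sub hcost hpot, integral_add hmom hS2, integral_const_mul,
      integral_add huint hSconj]
  calc ∫ x, ‖x - gradient u x‖ ^ 2 ∂μ
      = ∫ x, (‖x‖ ^ 2 + ‖gradient u x‖ ^ 2 - 2 * (u x + ustar (gradient u x))) ∂μ := by
        congr 1 with x
        rw [norm_sub_sq_real, hu.inner_gradient_eq_add_conjugate (hdiff x) (hustar _)]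
        ring
    _ = ∫ x, (‖x‖ ^ 2 + ‖T x‖ ^ 2 - 2 * (u x + ustar (T x))) ∂μ := by
        rw [(hsplit hgrad2 hconjgrad).2, (hsplit hT2 hTconj).2, hnorm, hconj]
    _ ≤ ∫ x, ‖x - T x‖ ^ 2 ∂μ := by
        refine integral_mono (hsplit hT2 hTconj).1
          (integrable_norm_sub_sq aestronglyMeasurable_id hT.aestronglyMeasurable hmom hT2)
          fun x => ?_
        have hFY : ⟪x, T x⟫ - u x ≤ ustar (T x) := (hustar (T x)).1 ⟨x, rfl⟩
        have hsq := norm_sub_sq_real x (T x)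
        dsimp only [id]
        linarith
end

section
/- Let y₁, …, y_m ∈ ℝⁿ, let ν₁, …, ν_m ≥ 0 with Σᵢ νᵢ = 1, let μ be a probability measure on ℝⁿ with finite first moment, and let E(h) = ∫ max_{1≤i≤m} (⟨x, y_i⟩ + h_i) dμ(x) − Σᵢ hᵢ νᵢ. Fix h ∈ ℝᵐ and assume the tie set {x ∈ ℝⁿ : the maximum max_{1≤i≤m}(⟨x, y_i⟩ + h_i) is attained at more than one index} has μ-measure zero. Then for each index i, the function s ↦ E(h + s·eᵢ) (where eᵢ is the i-th standard basis vector of ℝᵐ) is differentiable at s = 0, with derivative μ(W_i(h)) − νᵢ, where W_i(h) = {x ∈ ℝⁿ : ⟨x, y_i⟩ + h_i ≥ ⟨x, y_j⟩ + h_j for all j}. -/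
open MeasureTheory
open scoped RealInnerProductSpace

/-- The semi-discrete optimal transport energy
`E(h) = ∫ max_i (⟨x, y_i⟩ + h_i) dμ − Σᵢ hᵢ νᵢ`. -/
noncomputable def sdotEnergy {n m : ℕ}
    (y : Fin m → EuclideanSpace ℝ (Fin n)) (ν : Fin m → ℝ)
    (μ : Measure (EuclideanSpace ℝ (Fin n))) (h : Fin m → ℝ) : ℝ :=
  (∫ x, (⨆ i : Fin m, (⟪x, y i⟫ + h i)) ∂μ) - ∑ i, h i * ν i

theorem lipschitzWith_ciSup_add_ite {ι : Type*} [Fintype ι] [DecidableEq ι] [Nonempty ι]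
    (a : ι → ℝ) (i : ι) :
    LipschitzWith 1 (fun s : ℝ => ⨆ j, (a j + if j = i then s else 0)) := by
  refine LipschitzWith.of_le_add fun s t => ciSup_le fun j => ?_
  have hle := le_ciSup (Finite.bddAbove_range fun j => a j + if j = i then t else 0) j
  have hst : s - t ≤ dist s t := le_abs_self _
  have hd : 0 ≤ dist s t := dist_nonneg
  split_ifs at hle ⊢ <;> linarith

theorem hasDerivAt_ciSup_add_ite {ι : Type*} [Fintype ι] [DecidableEq ι]
    (a : ι → ℝ) (i j : ι) (hj : ∀ l, l ≠ j → a l < a j) :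
    HasDerivAt (fun s : ℝ => ⨆ l, (a l + if l = i then s else 0))
      (if j = i then 1 else 0) 0 := by
  have : Nonempty ι := ⟨j⟩
  have heq : (fun s : ℝ => ⨆ l, (a l + if l = i then s else 0)) =ᶠ[nhds 0]
      fun s => a j + if j = i then s else 0 := by
    have hev : ∀ l, ∀ᶠ s : ℝ in nhds 0,
        (a l + if l = i then s else 0) ≤ a j + if j = i then s else 0 := by
      intro l
      rcases eq_or_ne l j with rfl | hl
      · exact Filter.Eventually.of_forall fun s => le_rfl
      · have hc (k : ι) : ContinuousAt (fun s : ℝ => a k + if k = i then s else 0) 0 := by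
          split_ifs <;> fun_prop
        refine ((hc l).eventually_lt (hc j) ?_).mono fun s hs => hs.le
        simpa using hj l hl
    filter_upwards [Filter.eventually_all.2 hev] with s hs
    exact le_antisymm (ciSup_le hs)
      (le_ciSup (Finite.bddAbove_range fun l => a l + if l = i then s else 0) j)
  refine HasDerivAt.congr_of_eventuallyEq ?_ heq
  split_ifs
  · exact (hasDerivAt_id 0).const_add _
  · exact hasDerivAt_const _ _

theorem abs_ciSup_le_sum_abs {ι : Type*} [Fintype ι] [Nonempty ι] (a : ι → ℝ) :
    |⨆ j, a j| ≤ ∑ j, |a j| := by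
  obtain ⟨j, hj⟩ := exists_eq_ciSup_of_finite (f := a)
  rw [← hj]
  exact Finset.single_le_sum (f := fun j => |a j|) (fun _ _ => abs_nonneg _) (Finset.mem_univ j)

/-- If the tie set has `μ`-measure zero, the partial derivative of the
semi-discrete OT energy in the direction of the `i`-th standard basis vector
is `μ(W_i(h)) − νᵢ`, where `W_i(h)` is the `i`-th cell. -/
theorem sdot_energy_partial_deriv {n m : ℕ} (hm : 0 < m)
    (y : Fin m → EuclideanSpace ℝ (Fin n)) (ν : Fin m → ℝ)
    (hν : ∀ i, 0 ≤ ν i) (hνsum : ∑ i, ν i = 1)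
    (μ : Measure (EuclideanSpace ℝ (Fin n))) [IsProbabilityMeasure μ]
    (hmom : Integrable (fun x => ‖x‖) μ)
    (h : Fin m → ℝ)
    (htie : μ {x | ∃ j k : Fin m, j ≠ k ∧
      (∀ l, ⟪x, y l⟫ + h l ≤ ⟪x, y j⟫ + h j) ∧
      (∀ l, ⟪x, y l⟫ + h l ≤ ⟪x, y k⟫ + h k)} = 0)
    (i : Fin m) :
    HasDerivAt
      (fun s : ℝ => sdotEnergy y ν μ (fun j => h j + if j = i then s else 0))
      ((μ {x | ∀ j, ⟪x, y j⟫ + h j ≤ ⟪x, y i⟫ + h i}).toReal - ν i) 0 := by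
  have : Nonempty (Fin m) := ⟨⟨0, hm⟩⟩
  set W := {x | ∀ j, ⟪x, y j⟫ + h j ≤ ⟪x, y i⟫ + h i} with hW
  have hWmeas : MeasurableSet W := by
    rw [hW, Set.ofPred_forall]
    exact MeasurableSet.iInter fun j => measurableSet_le (by fun_prop) (by fun_prop)
  have hmeas (s : ℝ) : Measurable fun x : EuclideanSpace ℝ (Fin n) =>
      ⨆ j, (⟪x, y j⟫ + (h j + if j = i then s else 0)) :=
    Measurable.iSup fun j => by fun_prop
  have hid : Integrable (fun x : EuclideanSpace ℝ (Fin n) => x) μ :=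
    (integrable_norm_iff aestronglyMeasurable_id).1 hmom
  have hint : Integrable (fun x : EuclideanSpace ℝ (Fin n) =>
      ⨆ j, (⟪x, y j⟫ + (h j + if j = i then (0 : ℝ) else 0))) μ := by
    refine Integrable.mono' (g := fun x => ∑ j, |⟪x, y j⟫ + (h j + if j = i then (0 : ℝ) else 0)|)
      (integrable_finsetSum _ fun j _ => ?_) (hmeas 0).aestronglyMeasurable
      (Filter.Eventually.of_forall fun x => abs_ciSup_le_sum_abs _)
    exact ((hid.inner_const (y j)).add (integrable_const _)).abs
  have hmain := (hasDerivAt_integral_of_dominated_loc_of_lip (μ := μ) (x₀ := (0 : ℝ))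
    (F := fun s x => ⨆ j, (⟪x, y j⟫ + (h j + if j = i then s else 0)))
    (F' := W.indicator fun _ => (1 : ℝ)) (bound := fun _ => 1) Filter.univ_mem
    (Filter.Eventually.of_forall fun s => (hmeas s).aestronglyMeasurable) hint
    (measurable_const.indicator hWmeas).aestronglyMeasurable
    (Filter.Eventually.of_forall fun x => by
      simpa [add_assoc] using
        lipschitzWith_ciSup_add_ite (fun j => ⟪x, y j⟫ + h j) i)
    (integrable_const _) ?_).2
  · rw [integral_indicator_const _ hWmeas, smul_eq_mul, mul_one] at hmain
    refine hmain.sub ?_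
    have hsum : (fun s : ℝ => ∑ j, (h j + if j = i then s else 0) * ν j) =
        fun s => ∑ j, h j * ν j + s * ν i := by
      funext s
      simp [add_mul, Finset.sum_add_distrib]
    rw [hsum]
    simpa using ((hasDerivAt_id (0 : ℝ)).mul_const (ν i)).const_add (∑ j, h j * ν j)
  · filter_upwards [measure_eq_zero_iff_ae_notMem.1 htie] with x hx
    obtain ⟨j, hj⟩ := Finite.exists_max fun j => ⟪x, y j⟫ + h j
    have hlt : ∀ l, l ≠ j → ⟪x, y l⟫ + h l < ⟪x, y j⟫ + h j := fun l hl =>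
      (hj l).lt_of_ne fun he => hx ⟨l, j, hl, fun k => (hj k).trans he.ge, hj⟩
    have hmem : x ∈ W ↔ j = i :=
      ⟨fun hxW => by_contra fun hne => (hlt i (Ne.symm hne)).not_ge (hxW j),
        fun he => by subst he; exact hj⟩
    simpa [add_assoc, Set.indicator_apply, hmem] using
      hasDerivAt_ciSup_add_ite (fun j => ⟪x, y j⟫ + h j) i j hlt
end

section
/- Let y₁, …, y_m ∈ ℝⁿ, let ν₁, …, ν_m ≥ 0 with Σᵢ νᵢ = 1, let μ be a probability measure on ℝⁿ with finite first moment, and let E(h) = ∫ max_{1≤i≤m} (⟨x, y_i⟩ + h_i) dμ(x) − Σᵢ hᵢ νᵢ. Suppose h* ∈ ℝᵐ is a global minimizer of E over ℝᵐ, and assume the tie set {x ∈ ℝⁿ : the maximum max_{1≤i≤m}(⟨x, y_i⟩ + h*_i) is attained at more than one index} has μ-measure zero. Then μ(W_i(h*)) = νᵢ for every index i, and consequently the map M defined for μ-almost every x as the unique y_i attaining max_{1≤i≤m}(⟨x, y_i⟩ + h*_i) satisfies M#μ = Σᵢ νᵢ δ_{y_i}, i.e. M is measure-preserving from μ to the discrete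 target measure. -/
open MeasureTheory
open scoped RealInnerProductSpace

/-- The power cell of `i`: the points at which the index `i` attains the maximum defining the
Brenier potential with heights `h`. -/
def powerCell {E ι : Type*} [NormedAddCommGroup E] [InnerProductSpace ℝ E]
    (y : ι → E) (h : ι → ℝ) (i : ι) : Set E :=
  {x | ∀ j, ⟪x, y j⟫ + h j ≤ ⟪x, y i⟫ + h i}

theorem isClosed_powerCell {E ι : Type*} [NormedAddCommGroup E] [InnerProductSpace ℝ E]
    (y : ι → E) (h : ι → ℝ) (i : ι) : IsClosed (powerCell y h i) := by
  simp only [powerCell, Set.ofPred_forall]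
  exact isClosed_iInter fun j => isClosed_le (by fun_prop) (by fun_prop)

theorem iUnion_powerCell {E ι : Type*} [NormedAddCommGroup E] [InnerProductSpace ℝ E]
    [Finite ι] [Nonempty ι] (y : ι → E) (h : ι → ℝ) :
    ⋃ i, powerCell y h i = Set.univ := by
  refine Set.eq_univ_of_forall fun x => Set.mem_iUnion.2 ?_
  exact Finite.exists_max fun j => ⟪x, y j⟫ + h j

theorem abs_ciSup_sub_ciSup_le {ι : Type*} [Finite ι] [Nonempty ι] {a b : ι → ℝ} {C : ℝ}
    (hab : ∀ i, |a i - b i| ≤ C) : |(⨆ i, a i) - ⨆ i, b i| ≤ C := by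
  rw [abs_sub_le_iff]
  constructor
  · rw [sub_le_iff_le_add]
    refine ciSup_le fun i => ?_
    have := Finite.le_ciSup b i
    linarith [(abs_sub_le_iff.1 (hab i)).1]
  · rw [sub_le_iff_le_add]
    refine ciSup_le fun i => ?_
    have := Finite.le_ciSup a i
    linarith [(abs_sub_le_iff.1 (hab i)).2]

theorem hasDerivAt_ciSup_of_strict_max {ι : Type*} [Finite ι] {a : ι → ℝ} (c : ι → ℝ) {k : ι}
    (hk : ∀ j, j ≠ k → a j < a k) :
    HasDerivAt (fun t : ℝ => ⨆ j, (a j + t * c j)) (c k) 0 := by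
  have : Nonempty ι := ⟨k⟩
  have hlin : HasDerivAt (fun t : ℝ => a k + t * c k) (c k) 0 := by
    simpa using ((hasDerivAt_id (0 : ℝ)).mul_const (c k)).const_add (a k)
  refine hlin.congr_of_eventuallyEq ?_
  have hev : ∀ᶠ t : ℝ in nhds 0, ∀ j, a j + t * c j ≤ a k + t * c k := by
    refine Filter.eventually_all.2 fun j => ?_
    rcases eq_or_ne j k with rfl | hj
    · exact Filter.Eventually.of_forall fun _ => le_rfl
    · have h1 : ContinuousAt (fun t : ℝ => a j + t * c j) 0 := by fun_prop
      have h2 : ContinuousAt (fun t : ℝ => a k + t * c k) 0 := by fun_prop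
      exact (h1.eventually_lt h2 (by simpa using hk j hj)).mono fun _ => le_of_lt
  filter_upwards [hev] with t ht
  exact le_antisymm (ciSup_le ht) (Finite.le_ciSup (fun j => a j + t * c j) k)

theorem measurable_ciSup_inner_add {E ι : Type*} [NormedAddCommGroup E] [InnerProductSpace ℝ E]
    [MeasurableSpace E] [OpensMeasurableSpace E] [SecondCountableTopology E] [Finite ι]
    (y : ι → E) (h : ι → ℝ) : Measurable fun x : E => ⨆ i, (⟪x, y i⟫ + h i) :=
  Measurable.iSup fun _ => Continuous.measurable (by fun_prop)

theorem integrable_ciSup_inner_add {E ι : Type*} [NormedAddCommGroup E] [InnerProductSpace ℝ E]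
    [MeasurableSpace E] [OpensMeasurableSpace E] [SecondCountableTopology E]
    [Fintype ι] [Nonempty ι] {μ : Measure E} [IsFiniteMeasure μ]
    (hmom : Integrable (fun x => ‖x‖) μ) (y : ι → E) (h : ι → ℝ) :
    Integrable (fun x : E => ⨆ i, (⟪x, y i⟫ + h i)) μ := by
  have hbound : Integrable (fun x : E => ∑ i, (‖x‖ * ‖y i‖ + |h i|)) μ :=
    integrable_finsetSum _ fun i _ => (hmom.mul_const _).add (integrable_const _)
  refine hbound.mono' (measurable_ciSup_inner_add y h).aestronglyMeasurable
    (Filter.Eventually.of_forall fun x => ?_)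
  obtain ⟨i, hi⟩ := exists_eq_ciSup_of_finite (f := fun i => ⟪x, y i⟫ + h i)
  rw [← hi, Real.norm_eq_abs]
  calc |⟪x, y i⟫ + h i| ≤ |⟪x, y i⟫| + |h i| := abs_add_le _ _
    _ ≤ ‖x‖ * ‖y i‖ + |h i| := by gcongr; exact abs_real_inner_le_norm _ _
    _ ≤ ∑ i, (‖x‖ * ‖y i‖ + |h i|) :=
      Finset.single_le_sum (f := fun i => ‖x‖ * ‖y i‖ + |h i|)
        (fun _ _ => by positivity) (Finset.mem_univ i)

/-- Raising the `i`-th height at unit speed increases the integral of the Brenier potential at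
a rate equal to the mass of the `i`-th power cell, provided ties are negligible. -/
theorem hasDerivAt_integral_ciSup_inner_add {E ι : Type*} [NormedAddCommGroup E]
    [InnerProductSpace ℝ E] [MeasurableSpace E] [OpensMeasurableSpace E]
    [SecondCountableTopology E] [Fintype ι] [DecidableEq ι] [Nonempty ι]
    {μ : Measure E} [IsFiniteMeasure μ]
    (hmom : Integrable (fun x => ‖x‖) μ) (y : ι → E) (h : ι → ℝ)
    (htie : ∀ᵐ x ∂μ, ∀ j k, x ∈ powerCell y h j → x ∈ powerCell y h k → j = k) (i : ι) :
    HasDerivAt (fun t : ℝ => ∫ x, (⨆ j, (⟪x, y j⟫ + (h j + t * (Pi.single i 1 : ι → ℝ) j))) ∂μ)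
      (μ.real (powerCell y h i)) 0 := by
  have hcell := (isClosed_powerCell y h i).measurableSet
  rw [← integral_indicator_one hcell]
  refine (hasDerivAt_integral_of_dominated_loc_of_lip (s := Set.univ) (bound := fun _ => 1)
    Filter.univ_mem (Filter.Eventually.of_forall fun t =>
      (measurable_ciSup_inner_add y _).aestronglyMeasurable)
    (integrable_ciSup_inner_add hmom y _)
    ((measurable_one.indicator hcell).aestronglyMeasurable)
    (Filter.Eventually.of_forall fun x => ?_) (integrable_const _) ?_).2
  · refine LipschitzOnWith.of_dist_le_mul fun s _ t _ => ?_
    rw [Real.dist_eq, Real.dist_eq]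
    refine abs_ciSup_sub_ciSup_le fun j => ?_
    rcases eq_or_ne j i with rfl | hj <;> simp [*]
  · filter_upwards [htie] with x hx
    obtain ⟨k, hk⟩ : ∃ k, x ∈ powerCell y h k :=
      Set.mem_iUnion.1 (iUnion_powerCell y h ▸ Set.mem_univ x)
    have hstrict : ∀ j, j ≠ k → ⟪x, y j⟫ + h j < ⟪x, y k⟫ + h k := fun j hj =>
      (hk j).lt_of_ne fun he => hj (hx j k (fun l => he ▸ hk l) hk)
    have hval : (powerCell y h i).indicator (1 : E → ℝ) x = (Pi.single i 1 : ι → ℝ) k := by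
      rcases eq_or_ne k i with rfl | hki
      · simp [hk]
      · have : x ∉ powerCell y h i := fun hxi => hki (hx k i hk hxi)
        simp [this, hki]
    rw [hval]
    simpa only [add_assoc] using hasDerivAt_ciSup_of_strict_max (Pi.single i 1 : ι → ℝ) hstrict

/-- A map that is almost everywhere constant on each piece of a finite, almost everywhere
disjoint, measurable cover pushes the measure forward to a sum of Dirac masses. -/
theorem map_eq_sum_dirac_of_ae_eq_on_cover {α β ι : Type*} [MeasurableSpace α]
    [MeasurableSpace β] [Fintype ι] {μ : Measure α} {s : ι → Set α}
    (hs : ∀ i, MeasurableSet (s i)) (hcover : ⋃ i, s i = Set.univ)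
    (hd : Pairwise (Function.onFun (AEDisjoint μ) s)) {f : α → β} {y : ι → β}
    (hf : ∀ᵐ x ∂μ, ∀ i, x ∈ s i → f x = y i) :
    μ.map f = ∑ i, μ (s i) • Measure.dirac (y i) := by
  have hconst : ∀ i, f =ᵐ[μ.restrict (s i)] fun _ => y i := fun i =>
    (ae_restrict_iff' (hs i)).2 (hf.mono fun x hx => hx i)
  have hsum : Measure.sum (fun i => μ.restrict (s i)) = μ := by
    rw [← Measure.restrict_iUnion_ae hd fun i => (hs i).nullMeasurableSet, hcover,
      Measure.restrict_univ]
  have hmeas : AEMeasurable f (Measure.sum fun i => μ.restrict (s i)) :=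
    aemeasurable_sum_measure_iff.2 fun i => aemeasurable_const.congr (hconst i).symm
  conv_lhs => rw [← hsum]
  rw [Measure.map_sum hmeas, Measure.sum_fintype]
  refine Finset.sum_congr rfl fun i _ => ?_
  rw [Measure.map_congr (hconst i), Measure.map_const, Measure.restrict_apply_univ]

/-- At a global minimizer of the semi-discrete OT energy whose tie set is
`μ`-null, each cell `W_i(h*)` has `μ`-mass `νᵢ`, and hence the map sending
`μ`-almost every `x` to the unique `y_i` attaining the maximum pushes `μ`
forward onto the discrete target measure `Σᵢ νᵢ δ_{y_i}`. -/
theorem sdot_energy_minimizer_measure_preserving {n m : ℕ} (hm : 0 < m)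
    (y : Fin m → EuclideanSpace ℝ (Fin n)) (ν : Fin m → ℝ)
    (hν : ∀ i, 0 ≤ ν i) (hνsum : ∑ i, ν i = 1)
    (μ : Measure (EuclideanSpace ℝ (Fin n))) [IsProbabilityMeasure μ]
    (hmom : Integrable (fun x => ‖x‖) μ)
    (hstar : Fin m → ℝ)
    (hmin : ∀ g : Fin m → ℝ, sdotEnergy y ν μ hstar ≤ sdotEnergy y ν μ g)
    (htie : μ {x | ∃ j k : Fin m, j ≠ k ∧
      (∀ l, ⟪x, y l⟫ + hstar l ≤ ⟪x, y j⟫ + hstar j) ∧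
      (∀ l, ⟪x, y l⟫ + hstar l ≤ ⟪x, y k⟫ + hstar k)} = 0) :
    (∀ i : Fin m,
      μ {x | ∀ j, ⟪x, y j⟫ + hstar j ≤ ⟪x, y i⟫ + hstar i} =
        ENNReal.ofReal (ν i)) ∧
    ∀ M : EuclideanSpace ℝ (Fin n) → EuclideanSpace ℝ (Fin n),
      (∀ᵐ x ∂μ, ∀ i : Fin m,
        (∀ j, ⟪x, y j⟫ + hstar j ≤ ⟪x, y i⟫ + hstar i) → M x = y i) →
      μ.map M = ∑ i : Fin m, ENNReal.ofReal (ν i) • Measure.dirac (y i) := by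
  classical
  have : Nonempty (Fin m) := ⟨⟨0, hm⟩⟩
  have hunique : ∀ᵐ x ∂μ, ∀ j k, x ∈ powerCell y hstar j → x ∈ powerCell y hstar k → j = k := by
    refine measure_mono_null (fun x hx => ?_) htie
    by_contra hcon
    exact hx fun j k hj hk => by_contra fun hjk => hcon ⟨j, k, hjk, hj, hk⟩
  have hmass : ∀ i, μ (powerCell y hstar i) = ENNReal.ofReal (ν i) := by
    intro i
    have hlin : HasDerivAt
        (fun t : ℝ => ∑ j, (hstar j + t * (Pi.single i 1 : Fin m → ℝ) j) * ν j) (ν i) 0 := by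
      have hfun : (fun t : ℝ => ∑ j, (hstar j + t * (Pi.single i 1 : Fin m → ℝ) j) * ν j) =
          fun t => (∑ j, hstar j * ν j) + t * ν i := by
        funext t
        simp [add_mul, Finset.sum_add_distrib, Pi.single_apply]
      rw [hfun]
      simpa using ((hasDerivAt_id (0 : ℝ)).mul_const (ν i)).const_add (∑ j, hstar j * ν j)
    have hderiv := (hasDerivAt_integral_ciSup_inner_add hmom y hstar hunique i).sub hlin
    have hzero := IsLocalMin.hasDerivAt_eq_zero
      (Filter.Eventually.of_forall fun t => by
        simpa [sdotEnergy] using hmin fun j => hstar j + t * (Pi.single i 1 : Fin m → ℝ) j) hderiv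
    rw [← sub_eq_zero.1 hzero, ofReal_measureReal]
  refine ⟨hmass, fun M hM => ?_⟩
  rw [map_eq_sum_dirac_of_ae_eq_on_cover (s := powerCell y hstar)
    (fun i => (isClosed_powerCell y hstar i).measurableSet) (iUnion_powerCell y hstar) ?_ hM]
  · simp only [hmass]
  · refine fun j k hjk => measure_mono_null (fun x hx => ?_) htie
    exact ⟨j, k, hjk, hx.1, hx.2⟩
end
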